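/- Let g_1,…,g_n be vectors in ℝ^d with n ≥ 2, 1 ≤ m ≤ n, and suppose g = (1/n)∑_{i=1}^n g_i is nonzero. With ĝ_I = (1/m)∑_{i∈I} g_i for a uniformly random size-m subset I of {1,…,n} and γ = max_{i,j} |⟨g_i, g_j⟩|, the gradient norm stochasticity satisfies √(Var(‖ĝ_I‖))/E‖ĝ_I‖ ≤ √( (2(n−m)/(m(n−1))) · γ/‖g‖² ). -/

import Mathlib

open Finset RealInnerProductSpace

section PowersetCardSums

variable {ι E : Type*} [Fintype ι] [DecidableEq ι]

/-- Among the subsets of size `m`, the proportion of those containing `i` is `m / n`, where `n` is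
the size of the whole set. -/
lemma card_mul_card_powersetCard_filter_mem (m : ℕ) (i : ι) :
    Fintype.card ι * #{I ∈ powersetCard m (univ : Finset ι) | i ∈ I} =
      (Fintype.card ι).choose m * m := by
  rcases Nat.eq_zero_or_pos m with rfl | hm
  · simp
  · have h := card_filter_powersetCard_subset {i} univ m (subset_univ _)
      (by simpa using Nat.succ_le_of_lt hm)
    simp only [singleton_subset_iff, card_singleton, card_univ] at h
    have := Nat.choose_mul (n := Fintype.card ι) (k := m) (s := 1) hm
    rw [Nat.choose_one_right, Nat.choose_one_right] at this
    rw [h, this]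

/-- Among the subsets of size `m`, the proportion of those containing two given distinct elements
is `m (m - 1) / (n (n - 1))`. -/
lemma card_mul_card_powersetCard_filter_pair (m : ℕ) {i j : ι} (hij : i ≠ j) :
    (Fintype.card ι : ℝ) * (Fintype.card ι - 1) *
        #{I ∈ powersetCard m (univ : Finset ι) | i ∈ I ∧ j ∈ I} =
      (Fintype.card ι).choose m * (m * (m - 1)) := by
  rcases lt_or_ge m 2 with hm | hm
  · have h : #{I ∈ powersetCard m (univ : Finset ι) | i ∈ I ∧ j ∈ I} = 0 := by
      rw [card_eq_zero, filter_eq_empty_iff]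
      rintro I hI ⟨hi, hj⟩
      have := one_lt_card.2 ⟨i, hi, j, hj, hij⟩
      rw [mem_powersetCard_univ] at hI
      omega
    rw [h]
    interval_cases m <;> simp
  · have h := card_filter_powersetCard_subset {i, j} univ m (subset_univ _)
      (by simpa [card_pair hij] using hm)
    simp only [insert_subset_iff, singleton_subset_iff, card_pair hij, card_univ] at h
    have := congrArg (Nat.cast (R := ℝ))
      (Nat.choose_mul (n := Fintype.card ι) (k := m) (s := 2) hm)
    push_cast [Nat.cast_choose_two] at this
    rw [h]
    linarith

/-- The sums over all subsets of size `m` add up to a multiple of the full sum. -/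
lemma card_smul_sum_powersetCard_sum [AddCommGroup E] [Module ℝ E] (m : ℕ) (g : ι → E) :
    (Fintype.card ι : ℝ) • ∑ I ∈ powersetCard m (univ : Finset ι), ∑ i ∈ I, g i =
      ((Fintype.card ι).choose m * m : ℝ) • ∑ i, g i := by
  have h : ∑ I ∈ powersetCard m (univ : Finset ι), ∑ i ∈ I, g i =
      ∑ i, (#{I ∈ powersetCard m (univ : Finset ι) | i ∈ I} : ℝ) • g i := by
    have hI (I : Finset ι) : ∑ i ∈ I, g i = ∑ i, if i ∈ I then g i else 0 := by simp
    simp_rw [hI]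
    rw [sum_comm]
    refine sum_congr rfl fun i _ => ?_
    rw [← sum_filter, sum_const, Nat.cast_smul_eq_nsmul]
  rw [h, smul_sum, smul_sum]
  refine sum_congr rfl fun i _ => ?_
  rw [smul_smul]
  congr 1
  exact_mod_cast card_mul_card_powersetCard_filter_mem m i

/-- The second moment of the sum over a uniformly random subset of size `m`. -/
lemma card_mul_sum_powersetCard_norm_sum_sq [NormedAddCommGroup E] [InnerProductSpace ℝ E]
    (m : ℕ) (g : ι → E) :
    (Fintype.card ι : ℝ) * (Fintype.card ι - 1) *
        ∑ I ∈ powersetCard m (univ : Finset ι), ‖∑ i ∈ I, g i‖ ^ 2 =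
      (Fintype.card ι).choose m *
        (m * (m - 1) * ‖∑ i, g i‖ ^ 2 + m * (Fintype.card ι - m) * ∑ i, ‖g i‖ ^ 2) := by
  have h : ∑ I ∈ powersetCard m (univ : Finset ι), ‖∑ i ∈ I, g i‖ ^ 2 =
      ∑ i, ∑ j, (#{I ∈ powersetCard m (univ : Finset ι) | i ∈ I ∧ j ∈ I} : ℝ) * ⟪g i, g j⟫ := by
    have hI (I : Finset ι) : ‖∑ i ∈ I, g i‖ ^ 2 =
        ∑ i, ∑ j, if i ∈ I ∧ j ∈ I then ⟪g i, g j⟫ else 0 := by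
      simp_rw [← real_inner_self_eq_norm_sq, sum_inner, inner_sum]
      simp [ite_and]
    simp_rw [hI]
    rw [sum_comm]
    refine sum_congr rfl fun i _ => ?_
    rw [sum_comm]
    refine sum_congr rfl fun j _ => ?_
    rw [← sum_filter, sum_const, nsmul_eq_mul]
  have hij (i j : ι) : (Fintype.card ι : ℝ) * (Fintype.card ι - 1) *
        (#{I ∈ powersetCard m (univ : Finset ι) | i ∈ I ∧ j ∈ I} * ⟪g i, g j⟫) =
      (Fintype.card ι).choose m * (m * (m - 1) * ⟪g i, g j⟫ +
        if i = j then m * (Fintype.card ι - m) * ⟪g i, g j⟫ else 0) := by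
    split_ifs with hij
    · subst hij
      have := congrArg (Nat.cast (R := ℝ)) (card_mul_card_powersetCard_filter_mem m i)
      push_cast at this
      simp only [and_self]
      linear_combination ((Fintype.card ι : ℝ) - 1) * ⟪g i, g i⟫ * this
    · linear_combination ⟪g i, g j⟫ * card_mul_card_powersetCard_filter_pair m hij
  rw [h]
  simp_rw [mul_sum, hij, ← mul_sum, sum_add_distrib, ← mul_sum]
  simp_rw [← real_inner_self_eq_norm_sq, sum_inner, inner_sum]
  simp [mul_sum]

end PowersetCardSums

/-- With `g ≠ 0`, the gradient norm stochasticity satisfies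
`√(Var(‖ĝ_I‖))/E‖ĝ_I‖ ≤ √((2(n−m)/(m(n−1))) · γ/‖g‖²)`. -/
theorem gradient_norm_stochasticity_bound
    (d n m : ℕ) (hn : 2 ≤ n) (hm1 : 1 ≤ m) (hmn : m ≤ n)
    (g : Fin n → EuclideanSpace ℝ (Fin d))
    (hg : (n : ℝ)⁻¹ • ∑ i, g i ≠ 0) (γ : ℝ)
    (hγ : IsGreatest {x : ℝ | ∃ i j : Fin n, x = abs ⟪g i, g j⟫} γ) :
    Real.sqrt (((n.choose m : ℝ))⁻¹ *
            ∑ I ∈ Finset.powersetCard m (Finset.univ : Finset (Fin n)),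
              ‖(m : ℝ)⁻¹ • ∑ i ∈ I, g i‖ ^ 2
          - (((n.choose m : ℝ))⁻¹ *
              ∑ I ∈ Finset.powersetCard m (Finset.univ : Finset (Fin n)),
                ‖(m : ℝ)⁻¹ • ∑ i ∈ I, g i‖) ^ 2)
        / (((n.choose m : ℝ))⁻¹ *
            ∑ I ∈ Finset.powersetCard m (Finset.univ : Finset (Fin n)),
              ‖(m : ℝ)⁻¹ • ∑ i ∈ I, g i‖)
      ≤ Real.sqrt ((2 * ((n : ℝ) - (m : ℝ)) / ((m : ℝ) * ((n : ℝ) - 1))) *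
          (γ / ‖(n : ℝ)⁻¹ • ∑ i, g i‖ ^ 2)) := by
  have hn' : (2 : ℝ) ≤ n := by exact_mod_cast hn
  have hm' : (1 : ℝ) ≤ m := by exact_mod_cast hm1
  have hmn' : (m : ℝ) ≤ n := by exact_mod_cast hmn
  have hC : (0 : ℝ) < n.choose m := by exact_mod_cast Nat.choose_pos hmn
  have hn0 : (0 : ℝ) < n := by linarith
  have hm0 : (0 : ℝ) < m := by linarith
  have hn1 : (0 : ℝ) < (n : ℝ) - 1 := by linarith
  have hB : 0 < ‖(n : ℝ)⁻¹ • ∑ i, g i‖ := norm_pos_iff.2 hg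
  have first_moment : ‖(n : ℝ)⁻¹ • ∑ i, g i‖ ≤ (n.choose m : ℝ)⁻¹ *
      ∑ I ∈ powersetCard m (univ : Finset (Fin n)), ‖(m : ℝ)⁻¹ • ∑ i ∈ I, g i‖ := by
    have h := card_smul_sum_powersetCard_sum m g
    rw [Fintype.card_fin] at h
    have hmean : (n : ℝ)⁻¹ • ∑ i, g i = (n.choose m : ℝ)⁻¹ •
        ∑ I ∈ powersetCard m (univ : Finset (Fin n)), (m : ℝ)⁻¹ • ∑ i ∈ I, g i := by
      rw [← smul_sum, ← inv_smul_smul₀ hn0.ne' (∑ I ∈ powersetCard m univ, ∑ i ∈ I, g i), h]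
      simp only [smul_smul]
      congr 1
      field_simp
    rw [hmean, norm_smul, Real.norm_of_nonneg (inv_nonneg.2 hC.le)]
    gcongr
    exact norm_sum_le _ _
  have hγ_sq (i : Fin n) : ‖g i‖ ^ 2 ≤ γ := by
    rw [← real_inner_self_eq_norm_sq]
    exact (le_abs_self _).trans (hγ.2 ⟨i, i, rfl⟩)
  have hγ0 : 0 ≤ γ := (sq_nonneg _).trans (hγ_sq ⟨0, by omega⟩)
  have hsum : ∑ i, ‖g i‖ ^ 2 ≤ n * γ := by
    simpa using sum_le_card_nsmul univ _ γ fun i _ => hγ_sq i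
  have second_moment : (n.choose m : ℝ)⁻¹ *
      ∑ I ∈ powersetCard m (univ : Finset (Fin n)), ‖(m : ℝ)⁻¹ • ∑ i ∈ I, g i‖ ^ 2 =
      ‖(n : ℝ)⁻¹ • ∑ i, g i‖ ^ 2 + ((n : ℝ) - m) / (m * (n - 1)) *
        ((n : ℝ)⁻¹ * ∑ i, ‖g i‖ ^ 2 - ‖(n : ℝ)⁻¹ • ∑ i, g i‖ ^ 2) := by
    have h := card_mul_sum_powersetCard_norm_sum_sq m g
    rw [Fintype.card_fin, mul_comm, ← eq_div_iff (by positivity)] at h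
    simp_rw [norm_smul, mul_pow, ← mul_sum, h, norm_inv, Real.norm_natCast]
    field_simp
    ring
  have hc : 0 ≤ ((n : ℝ) - m) / (m * (n - 1)) := by
    have : 0 ≤ (n : ℝ) - m := by linarith
    positivity
  have hmean : (n : ℝ)⁻¹ * ∑ i, ‖g i‖ ^ 2 - ‖(n : ℝ)⁻¹ • ∑ i, g i‖ ^ 2 ≤ 2 * γ := by
    have : (n : ℝ)⁻¹ * ∑ i, ‖g i‖ ^ 2 ≤ γ := by rwa [inv_mul_le_iff₀ hn0]
    linarith [sq_nonneg ‖(n : ℝ)⁻¹ • ∑ i, g i‖]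
  rw [← mul_div_assoc, Real.sqrt_div' _ (sq_nonneg _), Real.sqrt_sq hB.le]
  refine div_le_div₀ (Real.sqrt_nonneg _) (Real.sqrt_le_sqrt ?_) hB first_moment
  rw [second_moment]
  calc _ ≤ ((n : ℝ) - m) / (m * (n - 1)) *
        ((n : ℝ)⁻¹ * ∑ i, ‖g i‖ ^ 2 - ‖(n : ℝ)⁻¹ • ∑ i, g i‖ ^ 2) := by
        linarith [pow_le_pow_left₀ hB.le first_moment 2]
    _ ≤ ((n : ℝ) - m) / (m * (n - 1)) * (2 * γ) := by gcongr
    _ = _ := by ring
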